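/- arXiv:cs/0607075 — 9 statements merged into one kernel-verified Lean document; each statement's English description precedes it below -/
import Mathlib

section
/- Let Z=(X,Y) be a mixed-pair random variable with associated density functions g_i, marginal probabilities p_i = ∫_ℝ g_i(y) dy, and marginal density g(y) = ∑_i g_i(y). Suppose (a) Y has a finite ε-th moment for some ε > 0, i.e. ∫_ℝ |y|^ε g(y) dy < ∞; (b) there exists δ > 0 such that ∫_ℝ g(y)^{1+δ} dy < ∞; and (c) X has finite discrete entropy, i.e. −∑_i p_i log p_i < ∞. Then Z is a good mixed-pair, i.e. ∑_i ∫_ℝ |g_i(y) log g_i(y)| dy < ∞. -/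
open MeasureTheory

/-- Weighting a pointwise convergent series of nonnegative measurable functions by a nonnegative
function commutes with integration. -/
theorem tsum_lintegral_ofReal_mul {α : Type*} [MeasurableSpace α] {μ : Measure α}
    {g : ℕ → α → ℝ} {G : α → ℝ} (hmeas : ∀ i, Measurable (g i)) (hnonneg : ∀ i y, 0 ≤ g i y)
    (hG : ∀ y, HasSum (fun i => g i y) (G y)) {F : α → ENNReal} (hF : Measurable F) :
    ∑' i, ∫⁻ y, ENNReal.ofReal (g i y) * F y ∂μ = ∫⁻ y, ENNReal.ofReal (G y) * F y ∂μ := by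
  rw [← lintegral_tsum fun i => by fun_prop]
  refine lintegral_congr fun y => ?_
  rw [ENNReal.tsum_mul_right, ← (hG y).tsum_eq,
    ENNReal.ofReal_tsum_of_nonneg (fun i => hnonneg i y) (hG y).summable]

theorem log_one_add_abs_le {ε : ℝ} (hε : 0 < ε) (y : ℝ) :
    Real.log (1 + |y|) ≤ 1 + |y| ^ ε / ε := by
  have hlog2 : Real.log 2 ≤ 1 := by linarith [Real.log_two_lt_d9]
  have hy := abs_nonneg y
  have hpow : 0 ≤ |y| ^ ε / ε := by positivity
  rcases le_total |y| 1 with h | h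
  · have := Real.log_le_log (by positivity : 0 < 1 + |y|) (by linarith : 1 + |y| ≤ 2)
    linarith
  · have h1 := Real.log_le_log (by positivity : 0 < 1 + |y|) (by linarith : 1 + |y| ≤ 2 * |y|)
    rw [Real.log_mul (by norm_num) (by positivity)] at h1
    linarith [Real.log_le_rpow_div hy hε]

/-- Gibbs-type pointwise bound: compare `x` with a larger value `s` where `x ≥ 1`, and with the
reference density `q * (1 + |y|) ^ (-2)` where `x ≤ 1`. -/
theorem abs_mul_log_le {x s q y δ ε : ℝ} (hx : 0 ≤ x) (hxs : x ≤ s) (hq : 0 < q) (hq1 : q ≤ 1)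
    (hδ : 0 < δ) (hε : 0 < ε) :
    |x * Real.log x| ≤ x * (s ^ δ / δ + (-Real.log q) + (2 + 2 / ε * |y| ^ ε))
      + q * (1 + |y|) ^ (-2 : ℝ) := by
  have hs : 0 ≤ s := hx.trans hxs
  have hlq : 0 ≤ -Real.log q := by linarith [Real.log_nonpos hq.le hq1]
  have hw : 0 < (1 + |y|) ^ (-2 : ℝ) := by positivity
  have h1 : 0 ≤ s ^ δ / δ := by positivity
  have h2 : 0 ≤ 2 + 2 / ε * |y| ^ ε := by positivity
  rcases hx.eq_or_lt with rfl | hx0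
  · simp only [zero_mul, abs_zero, zero_add]; positivity
  rcases le_total 1 x with h | h
  · have hl := Real.log_nonneg h
    have hls : Real.log x ≤ s ^ δ / δ :=
      (Real.log_le_log hx0 hxs).trans (Real.log_le_rpow_div hs hδ)
    rw [abs_of_nonneg (by positivity)]
    have := mul_le_mul_of_nonneg_left
      (by linarith : Real.log x ≤ s ^ δ / δ + (-Real.log q) + (2 + 2 / ε * |y| ^ ε)) hx
    have : 0 < q * (1 + |y|) ^ (-2 : ℝ) := by positivity
    linarith
  · have hl := Real.log_nonpos hx h
    rw [abs_of_nonpos (mul_nonpos_of_nonneg_of_nonpos hx hl)]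
    set w := (1 + |y|) ^ (-2 : ℝ) with hwdef
    have hlw : -Real.log w ≤ 2 + 2 / ε * |y| ^ ε := by
      have h3 := log_one_add_abs_le hε y
      rw [hwdef, Real.log_rpow (by positivity)]
      have : 2 / ε * |y| ^ ε = 2 * (|y| ^ ε / ε) := by ring
      linarith
    have hgibbs := Real.log_le_sub_one_of_pos (by positivity : 0 < q * w / x)
    rw [Real.log_div (by positivity) hx0.ne', Real.log_mul hq.ne' hw.ne'] at hgibbs
    have h4 := mul_le_mul_of_nonneg_left (show -Real.log x ≤
      (s ^ δ / δ + (-Real.log q) + (2 + 2 / ε * |y| ^ ε)) + q * w / x by linarith) hx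
    rw [mul_add, mul_div_cancel₀ _ hx0.ne'] at h4
    linarith

/- STATEMENT 0: Sufficient conditions (finite ε-th moment of the continuous part,
finite ∫ g^{1+δ}, and finite discrete entropy) for a mixed-pair random variable
Z = (X, Y), described by its joint density functions gᵢ, to be a *good* mixed-pair,
i.e. ∑ᵢ ∫ℝ |gᵢ(y) log gᵢ(y)| dy < ∞. -/
theorem good_mixed_pair_sufficient_conditions
    (g : ℕ → ℝ → ℝ) (G : ℝ → ℝ) (p : ℕ → ℝ)
    (hmeas : ∀ i, Measurable (g i))
    (hnonneg : ∀ i y, 0 ≤ g i y)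
    (hG : ∀ y, HasSum (fun i => g i y) (G y))
    (hp : ∀ i, ∫⁻ y, ENNReal.ofReal (g i y) = ENNReal.ofReal (p i))
    (htotal : ∑' i, ∫⁻ y, ENNReal.ofReal (g i y) = 1)
    (ha : ∃ ε > (0 : ℝ), ∫⁻ y, ENNReal.ofReal (|y| ^ ε * G y) < ⊤)
    (hb : ∃ δ > (0 : ℝ), ∫⁻ y, ENNReal.ofReal (G y ^ (1 + δ)) < ⊤)
    (hc : ∑' i, ENNReal.ofReal (-(p i * Real.log (p i))) < ⊤) :
    ∑' i, ∫⁻ y, ENNReal.ofReal |g i y * Real.log (g i y)| < ⊤ := by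
  obtain ⟨ε, hε, ha⟩ := ha
  obtain ⟨δ, hδ, hb⟩ := hb
  have hG0 : ∀ y, 0 ≤ G y := fun y => (hG y).nonneg fun i => hnonneg i y
  have hgG : ∀ i y, g i y ≤ G y := fun i y => le_hasSum (hG y) i fun j _ => hnonneg j y
  have hGmeas : Measurable G := by
    have : G = fun y => (∑' i, ENNReal.ofReal (g i y)).toReal := by
      ext y
      rw [← ENNReal.ofReal_tsum_of_nonneg (fun i => hnonneg i y) (hG y).summable, (hG y).tsum_eq,
        ENNReal.toReal_ofReal (hG0 y)]
    rw [this]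
    exact (Measurable.tsum fun i => (hmeas i).ennreal_ofReal).ennreal_toReal
  have hp1 : ∀ i, p i ≤ 1 := fun i => by
    have : ENNReal.ofReal (p i) ≤ 1 := by
      rw [← hp i, ← htotal]
      exact ENNReal.le_tsum i
    simpa using this
  set F : ℝ → ENNReal := fun y =>
    ENNReal.ofReal (G y ^ δ / δ) + ENNReal.ofReal (2 + 2 / ε * |y| ^ ε) with hFdef
  have hF : Measurable F := by fun_prop
  set W : ENNReal := ∫⁻ y : ℝ, ENNReal.ofReal ((1 + |y|) ^ (-2 : ℝ))
  have hWfin : W < ⊤ := by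
    simpa only [Real.norm_eq_abs] using finite_integral_one_add_norm (E := ℝ) (μ := volume) (r := 2) (by simp)
  have hbound : ∀ i, ∫⁻ y, ENNReal.ofReal |g i y * Real.log (g i y)| ≤
      (∫⁻ y, ENNReal.ofReal (g i y) * F y) + ENNReal.ofReal (-(p i * Real.log (p i)))
        + (∫⁻ y, ENNReal.ofReal (g i y)) * W := by
    intro i
    rcases le_or_gt (p i) 0 with hi | hi
    · have h0 := hp i
      rw [ENNReal.ofReal_of_nonpos hi, lintegral_eq_zero_iff (hmeas i).ennreal_ofReal] at h0
      have h1 : ∫⁻ y, ENNReal.ofReal |g i y * Real.log (g i y)| = 0 := by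
        rw [← lintegral_zero (μ := (volume : Measure ℝ))]
        refine lintegral_congr_ae ?_
        filter_upwards [h0] with y hy
        have : g i y = 0 := le_antisymm (ENNReal.ofReal_eq_zero.1 hy) (hnonneg i y)
        simp [this]
      exact h1.trans_le zero_le
    · have hlq : 0 ≤ -Real.log (p i) := by linarith [Real.log_nonpos hi.le (hp1 i)]
      have hpt : ∀ y, ENNReal.ofReal |g i y * Real.log (g i y)| ≤
          ENNReal.ofReal (g i y) * F y + ENNReal.ofReal (g i y) * ENNReal.ofReal (-Real.log (p i))
            + ENNReal.ofReal (p i) * ENNReal.ofReal ((1 + |y|) ^ (-2 : ℝ)) := by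
        intro y
        have hx := hnonneg i y
        have hGy := hG0 y
        have h1 : 0 ≤ G y ^ δ / δ := by positivity
        have h2 : 0 ≤ 2 + 2 / ε * |y| ^ ε := by positivity
        refine (ENNReal.ofReal_le_ofReal
          (abs_mul_log_le (y := y) hx (hgG i y) hi (hp1 i) hδ hε)).trans_eq ?_
        rw [ENNReal.ofReal_add (by positivity) (by positivity), ENNReal.ofReal_mul hx,
          ENNReal.ofReal_add (by positivity) h2, ENNReal.ofReal_add h1 hlq,
          ENNReal.ofReal_mul hi.le, hFdef]
        ring
      refine (lintegral_mono hpt).trans_eq ?_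
      have hg := (hmeas i).ennreal_ofReal
      rw [lintegral_add_left (by fun_prop), lintegral_add_left (by fun_prop),
        lintegral_mul_const _ hg, lintegral_const_mul _ (by fun_prop), hp i,
        ← ENNReal.ofReal_mul hi.le, mul_neg]
  refine (ENNReal.tsum_le_tsum hbound).trans_lt ?_
  rw [ENNReal.tsum_add, ENNReal.tsum_add, ENNReal.tsum_mul_right, htotal, one_mul,
    tsum_lintegral_ofReal_mul hmeas hnonneg hG hF]
  refine ENNReal.add_lt_top.2 ⟨ENNReal.add_lt_top.2 ⟨?_, hc⟩, hWfin⟩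
  have hGint : ∫⁻ y, ENNReal.ofReal (G y) = 1 := by
    simpa [htotal] using
      (tsum_lintegral_ofReal_mul (μ := volume) hmeas hnonneg hG (F := fun _ => 1)
        measurable_const).symm
  have hsplit : ∀ y, ENNReal.ofReal (G y) * F y =
      ENNReal.ofReal (1 / δ) * ENNReal.ofReal (G y ^ (1 + δ)) + (2 * ENNReal.ofReal (G y)
        + ENNReal.ofReal (2 / ε) * ENNReal.ofReal (|y| ^ ε * G y)) := by
    intro y
    have hGy := hG0 y
    have h2 : (2 : ENNReal) = ENNReal.ofReal 2 := by simp
    simp only [hFdef]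
    rw [h2, ← ENNReal.ofReal_mul (by positivity), ← ENNReal.ofReal_mul (by positivity),
      ← ENNReal.ofReal_mul (by positivity), ← ENNReal.ofReal_add (by positivity) (by positivity),
      ← ENNReal.ofReal_add (by positivity) (by positivity), ← ENNReal.ofReal_mul (by positivity),
      ← ENNReal.ofReal_add (by positivity) (by positivity),
      Real.rpow_add' hGy (by positivity), Real.rpow_one]
    congr 1
    ring
  rw [lintegral_congr hsplit, lintegral_add_left (by fun_prop), lintegral_add_left (by fun_prop),
    lintegral_const_mul _ (by fun_prop), lintegral_const_mul _ (by fun_prop),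
    lintegral_const_mul _ (by fun_prop), hGint]
  exact ENNReal.add_lt_top.2 ⟨ENNReal.mul_lt_top ENNReal.ofReal_lt_top hb,
    ENNReal.add_lt_top.2 ⟨by simp, ENNReal.mul_lt_top ENNReal.ofReal_lt_top ha⟩⟩
end

section
/- Let Z=(X^d,Y^d) be a vector of mixed-pair random variables with associated density functions g_x : ℝ^d → [0,∞) indexed by x in a countable set S^d ⊂ ℝ^d, marginal probabilities p_x = ∫_{ℝ^d} g_x(y) dy, and marginal density g(y) = ∑_{x ∈ S^d} g_x(y). Suppose (a) Y^d has a finite ε-th moment for some ε > 0, i.e. ∫_{ℝ^d} ‖y‖^ε g(y) dy < ∞; (b) there exists δ > 0 such that ∫_{ℝ^d} g(y)^{1+δ} dy < ∞; and (c) X^d has finite discrete entropy, i.e. −∑_{x ∈ S^d} p_x log p_x < ∞. Then Z is a good vector of mixed-pairs, i.e. ∑_{x ∈ S^d} ∫_{ℝ^d} |g_x(y) log g_x(y)| dy < ∞. -/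
open MeasureTheory in
/-- Integrating a nonnegative weight against a pointwise sum of nonnegative functions. -/
theorem tsum_lintegral_ofReal_mul_of_hasSum {α : Type*} [MeasurableSpace α] {μ : Measure α}
    {g : ℕ → α → ℝ} {G f : α → ℝ} (hmeas : ∀ i, Measurable (g i)) (hnonneg : ∀ i y, 0 ≤ g i y)
    (hG : ∀ y, HasSum (fun i => g i y) (G y)) (hf : Measurable f) (hf0 : ∀ y, 0 ≤ f y) :
    ∑' i, ∫⁻ y, ENNReal.ofReal (f y * g i y) ∂μ = ∫⁻ y, ENNReal.ofReal (f y * G y) ∂μ := by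
  rw [← lintegral_tsum (by fun_prop)]
  refine lintegral_congr fun y => ?_
  have h := (hG y).mul_left (f y)
  rw [← ENNReal.ofReal_tsum_of_nonneg (fun i => mul_nonneg (hf0 y) (hnonneg i y)) h.summable,
    h.tsum_eq]

/-- A pointwise entropy bound comparing `x` with a reference weight `p * w`. -/
theorem abs_mul_log_le_of_le {x X p w δ : ℝ} (hx : 0 ≤ x) (hX : x ≤ X) (hp : 0 < p) (hp1 : p ≤ 1)
    (hw : 0 < w) (hw1 : w ≤ 1) (hδ : 0 < δ) :
    |x * Real.log x| ≤ p * w + -Real.log p * x + -Real.log w * x + X ^ δ / δ * x := by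
  have hlp : 0 ≤ -Real.log p * x :=
    mul_nonneg (neg_nonneg.2 (Real.log_nonpos hp.le hp1)) hx
  have hlw : 0 ≤ -Real.log w * x :=
    mul_nonneg (neg_nonneg.2 (Real.log_nonpos hw.le hw1)) hx
  have hpw : 0 < p * w := mul_pos hp hw
  have hXδ : 0 ≤ X ^ δ / δ * x := by
    have : 0 ≤ X := hx.trans hX
    positivity
  rcases hx.eq_or_lt with rfl | hx'
  · simp only [zero_mul, abs_zero]; linarith
  rw [abs_le']
  constructor
  · have h1 : Real.log x ≤ X ^ δ / δ :=
      (Real.log_le_log hx' hX).trans (Real.log_le_rpow_div (hx.trans hX) hδ)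
    have h2 := mul_le_mul_of_nonneg_right h1 hx
    linarith
  · have h1 := Real.log_le_sub_one_of_pos (div_pos hpw hx')
    rw [Real.log_div hpw.ne' hx'.ne', Real.log_mul hp.ne' hw.ne'] at h1
    have h2 := mul_le_mul_of_nonneg_right h1 hx
    have h3 : (p * w / x - 1) * x = p * w - x := by field_simp
    linarith

/-- Logarithmic growth is dominated by any positive power. -/
theorem log_one_add_le_mul_one_add_rpow {r ε : ℝ} (hr : 0 ≤ r) (hε : 0 < ε) :
    Real.log (1 + r) ≤ 2 ^ ε / ε * (1 + r ^ ε) := by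
  have h1 : (1 + r) ^ ε ≤ 2 ^ ε * (1 + r ^ ε) := by
    have hr' : 0 ≤ r ^ ε := Real.rpow_nonneg hr ε
    have h2 : (0 : ℝ) < 2 ^ ε := by positivity
    rcases le_total r 1 with h | h
    · calc (1 + r) ^ ε ≤ 2 ^ ε := Real.rpow_le_rpow (by linarith) (by linarith) hε.le
        _ ≤ 2 ^ ε * (1 + r ^ ε) := le_mul_of_one_le_right h2.le (by linarith)
    · calc (1 + r) ^ ε ≤ (2 * r) ^ ε := Real.rpow_le_rpow (by linarith) (by linarith) hε.le
        _ = 2 ^ ε * r ^ ε := Real.mul_rpow (by norm_num) hr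
        _ ≤ 2 ^ ε * (1 + r ^ ε) := by gcongr; linarith
  calc Real.log (1 + r) ≤ (1 + r) ^ ε / ε := Real.log_le_rpow_div (by linarith) hε
    _ ≤ 2 ^ ε * (1 + r ^ ε) / ε := by gcongr
    _ = 2 ^ ε / ε * (1 + r ^ ε) := by ring

/- STATEMENT 1: Sufficient conditions for a vector of mixed-pair random variables
Z = (X^d, Y^d), described by its joint density functions g_x : ℝ^d → [0,∞) indexed by
a countable set, to be a *good* vector of mixed-pairs:
∑_x ∫_{ℝ^d} |g_x(y) log g_x(y)| dy < ∞. -/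
theorem good_mixed_pair_vector_sufficient_conditions
    (d : ℕ)
    (g : ℕ → EuclideanSpace ℝ (Fin d) → ℝ) (G : EuclideanSpace ℝ (Fin d) → ℝ) (p : ℕ → ℝ)
    (hmeas : ∀ i, Measurable (g i))
    (hnonneg : ∀ i y, 0 ≤ g i y)
    (hG : ∀ y, HasSum (fun i => g i y) (G y))
    (hp : ∀ i, ∫⁻ y, ENNReal.ofReal (g i y) = ENNReal.ofReal (p i))
    (htotal : ∑' i, ∫⁻ y, ENNReal.ofReal (g i y) = 1)
    (ha : ∃ ε > (0 : ℝ), ∫⁻ y, ENNReal.ofReal (‖y‖ ^ ε * G y) < ⊤)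
    (hb : ∃ δ > (0 : ℝ), ∫⁻ y, ENNReal.ofReal (G y ^ (1 + δ)) < ⊤)
    (hc : ∑' i, ENNReal.ofReal (-(p i * Real.log (p i))) < ⊤) :
    ∑' i, ∫⁻ y, ENNReal.ofReal |g i y * Real.log (g i y)| < ⊤ := by
  obtain ⟨ε, hε, ha⟩ := ha
  obtain ⟨δ, hδ, hb⟩ := hb
  have hGm : Measurable G := by
    refine measurable_of_tendsto_metrizable
      (fun n => Finset.measurable_sum (Finset.range n) fun i _ => hmeas i) ?_
    rw [tendsto_pi_nhds]
    intro y
    simpa using (hG y).tendsto_sum_nat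
  have hG0 : ∀ y, 0 ≤ G y := fun y => (hG y).nonneg fun i => hnonneg i y
  have hgG : ∀ i y, g i y ≤ G y := fun i y => le_hasSum (hG y) i fun j _ => hnonneg j y
  have hGint : ∫⁻ y, ENNReal.ofReal (G y) = 1 := by
    have h := tsum_lintegral_ofReal_mul_of_hasSum (μ := MeasureTheory.volume) (f := fun _ => 1)
      hmeas hnonneg hG measurable_const (fun _ => zero_le_one)
    simpa [htotal] using h.symm
  have hsum : ∑' i, ENNReal.ofReal (p i) = 1 := by simpa only [hp] using htotal
  have hp1 : ∀ i, p i ≤ 1 := fun i =>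
    ENNReal.ofReal_le_one.1 (hsum ▸ ENNReal.le_tsum i)
  set C : ℝ := (d + 1) * (2 ^ ε / ε) with hC
  have hC0 : 0 ≤ C := by positivity
  set w : EuclideanSpace ℝ (Fin d) → ℝ := fun y => (1 + ‖y‖) ^ (-((d : ℝ) + 1)) with hw
  set u : EuclideanSpace ℝ (Fin d) → ℝ := fun y => C * (1 + ‖y‖ ^ ε) with hu
  set v : EuclideanSpace ℝ (Fin d) → ℝ := fun y => G y ^ δ / δ with hv
  have hwm : Measurable w := by fun_prop
  have hum : Measurable u := by fun_prop
  have hvm : Measurable v := by fun_prop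
  have hw0 : ∀ y, 0 < w y := fun y => by positivity
  have hu0 : ∀ y, 0 ≤ u y := fun y => by positivity
  have hv0 : ∀ y, 0 ≤ v y := fun y => div_nonneg (Real.rpow_nonneg (hG0 y) δ) hδ.le
  have hw1 : ∀ y, w y ≤ 1 := fun y =>
    Real.rpow_le_one_of_one_le_of_nonpos (by linarith [norm_nonneg y])
      (by linarith [(Nat.cast_nonneg d : (0 : ℝ) ≤ d)])
  have hwu : ∀ y, -Real.log (w y) ≤ u y := fun y => by
    simp only [hw, hu, hC]
    rw [Real.log_rpow (by positivity), neg_mul, neg_neg, mul_assoc]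
    exact mul_le_mul_of_nonneg_left (log_one_add_le_mul_one_add_rpow (norm_nonneg y) hε)
      (by positivity)
  have hwint : ∫⁻ y, ENNReal.ofReal (w y) < ⊤ :=
    (integrable_one_add_norm (by simp)).lintegral_lt_top
  have huint : ∫⁻ y, ENNReal.ofReal (u y * G y) < ⊤ := by
    have h : ∀ y, ENNReal.ofReal (u y * G y) = ENNReal.ofReal C *
        (ENNReal.ofReal (G y) + ENNReal.ofReal (‖y‖ ^ ε * G y)) := fun y => by
      rw [← ENNReal.ofReal_add (hG0 y) (mul_nonneg (by positivity) (hG0 y)),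
        ← ENNReal.ofReal_mul hC0]
      congr 1
      simp only [hu]
      ring
    simp only [h]
    rw [MeasureTheory.lintegral_const_mul _ (by fun_prop),
      MeasureTheory.lintegral_add_left (by fun_prop), hGint]
    exact ENNReal.mul_lt_top ENNReal.ofReal_lt_top (ENNReal.add_lt_top.2 ⟨ENNReal.one_lt_top, ha⟩)
  have hvint : ∫⁻ y, ENNReal.ofReal (v y * G y) < ⊤ := by
    have h : ∀ y, ENNReal.ofReal (v y * G y) =
        ENNReal.ofReal δ⁻¹ * ENNReal.ofReal (G y ^ (1 + δ)) := fun y => by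
      rw [← ENNReal.ofReal_mul (by positivity), Real.rpow_add' (hG0 y) (by positivity),
        Real.rpow_one]
      congr 1
      simp only [hv]
      ring
    simp only [h]
    rw [MeasureTheory.lintegral_const_mul _ (by fun_prop)]
    exact ENNReal.mul_lt_top ENNReal.ofReal_lt_top hb
  have key : ∀ i, ∫⁻ y, ENNReal.ofReal |g i y * Real.log (g i y)| ≤
      ENNReal.ofReal (p i) * (∫⁻ y, ENNReal.ofReal (w y)) +
        ENNReal.ofReal (-(p i * Real.log (p i))) +
        (∫⁻ y, ENNReal.ofReal (u y * g i y)) + ∫⁻ y, ENNReal.ofReal (v y * g i y) := by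
    intro i
    have hgm := hmeas i
    rcases le_or_gt (p i) 0 with hpi | hpi
    · have h := hp i
      rw [ENNReal.ofReal_of_nonpos hpi, MeasureTheory.lintegral_eq_zero_iff (by fun_prop)] at h
      have h0 : ∫⁻ y, ENNReal.ofReal |g i y * Real.log (g i y)| = 0 := by
        rw [MeasureTheory.lintegral_eq_zero_iff (by fun_prop)]
        filter_upwards [h] with y hy
        have hy0 : g i y = 0 := le_antisymm (ENNReal.ofReal_eq_zero.1 hy) (hnonneg i y)
        simp [hy0]
      rw [h0]
      exact zero_le
    · have hlp : 0 ≤ -Real.log (p i) := neg_nonneg.2 (Real.log_nonpos hpi.le (hp1 i))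
      calc ∫⁻ y, ENNReal.ofReal |g i y * Real.log (g i y)|
          ≤ ∫⁻ y, (ENNReal.ofReal (p i) * ENNReal.ofReal (w y) +
              ENNReal.ofReal (-Real.log (p i)) * ENNReal.ofReal (g i y) +
              ENNReal.ofReal (u y * g i y) + ENNReal.ofReal (v y * g i y)) := by
            refine MeasureTheory.lintegral_mono fun y => ?_
            have hg := hnonneg i y
            have hug := mul_nonneg (hu0 y) hg
            have hvg := mul_nonneg (hv0 y) hg
            have hpw := mul_nonneg hpi.le (hw0 y).le
            have hlg := mul_nonneg hlp hg
            rw [← ENNReal.ofReal_mul hpi.le, ← ENNReal.ofReal_mul hlp,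
              ← ENNReal.ofReal_add hpw hlg, ← ENNReal.ofReal_add (by positivity) hug,
              ← ENNReal.ofReal_add (by positivity) hvg]
            refine ENNReal.ofReal_le_ofReal ?_
            have h := abs_mul_log_le_of_le hg (hgG i y) hpi (hp1 i) (hw0 y) (hw1 y) hδ
            have h' := mul_le_mul_of_nonneg_right (hwu y) hg
            simp only [hv]
            linarith
        _ = _ := by
            rw [MeasureTheory.lintegral_add_left (by fun_prop),
              MeasureTheory.lintegral_add_left (by fun_prop),
              MeasureTheory.lintegral_add_left (by fun_prop),
              MeasureTheory.lintegral_const_mul _ (by fun_prop),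
              MeasureTheory.lintegral_const_mul _ (by fun_prop), hp i, ← ENNReal.ofReal_mul hlp,
              neg_mul, mul_comm (Real.log (p i))]
  refine (ENNReal.tsum_le_tsum key).trans_lt ?_
  rw [ENNReal.tsum_add, ENNReal.tsum_add, ENNReal.tsum_add, ENNReal.tsum_mul_right, hsum, one_mul,
    tsum_lintegral_ofReal_mul_of_hasSum hmeas hnonneg hG hum hu0,
    tsum_lintegral_ofReal_mul_of_hasSum hmeas hnonneg hG hvm hv0]
  simp only [ENNReal.add_lt_top]
  exact ⟨⟨⟨hwint, hc⟩, huint⟩, hvint⟩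
end

section
/- Let g : ℝ → [0,∞) be a probability density function (∫_ℝ g(y) dy = 1) such that ∫_ℝ g(y)^{1+δ} dy < ∞ for some δ > 0. Suppose g can be written as a countable sum g(y) = ∑_i g_i(y) of nonnegative measurable functions g_i. Then ∑_i ∫_ℝ g_i(y) (log g_i(y))_+ dy < ∞, where (a)_+ = max(a,0). -/
theorem max_log_zero_le_rpow_div {x y δ : ℝ} (hx : 0 ≤ x) (hxy : x ≤ y) (hδ : 0 < δ) :
    max (Real.log x) 0 ≤ y ^ δ / δ :=
  max_le
    ((Real.log_le_rpow_div hx hδ).trans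
      (div_le_div_of_nonneg_right (Real.rpow_le_rpow hx hxy hδ.le) hδ.le))
    (div_nonneg (Real.rpow_nonneg (hx.trans hxy) δ) hδ.le)

/- STATEMENT 2: If g is a probability density on ℝ with ∫ g^{1+δ} < ∞ for some δ > 0,
and g = ∑ᵢ gᵢ is a countable sum of nonnegative measurable functions, then
∑ᵢ ∫ gᵢ(y) (log gᵢ(y))₊ dy < ∞. -/
theorem sum_integral_pos_part_log_lt_top
    (g : ℕ → ℝ → ℝ) (G : ℝ → ℝ)
    (hmeas : ∀ i, Measurable (g i))
    (hnonneg : ∀ i y, 0 ≤ g i y)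
    (hGmeas : Measurable G)
    (hGnonneg : ∀ y, 0 ≤ G y)
    (hpdf : ∫ y, G y = 1)
    (hG : ∀ y, HasSum (fun i => g i y) (G y))
    (hb : ∃ δ > (0 : ℝ), ∫⁻ y, ENNReal.ofReal (G y ^ (1 + δ)) < ⊤) :
    ∑' i, ∫⁻ y, ENNReal.ofReal (g i y * max (Real.log (g i y)) 0) < ⊤ := by
  obtain ⟨δ, hδ, hfin⟩ := hb
  have hle : ∀ i y, g i y * max (Real.log (g i y)) 0 ≤ g i y * (G y ^ δ / δ) := fun i y =>
    mul_le_mul_of_nonneg_left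
      (max_log_zero_le_rpow_div (hnonneg i y)
        (le_hasSum (hG y) i fun j _ => hnonneg j y) hδ)
      (hnonneg i y)
  have hsum : ∀ y, ∑' i, ENNReal.ofReal (g i y * (G y ^ δ / δ)) =
      ENNReal.ofReal δ⁻¹ * ENNReal.ofReal (G y ^ (1 + δ)) := fun y => by
    have hs := (hG y).mul_right (G y ^ δ / δ)
    have hc : 0 ≤ G y ^ δ / δ := div_nonneg (Real.rpow_nonneg (hGnonneg y) δ) hδ.le
    rw [← ENNReal.ofReal_tsum_of_nonneg (fun i => mul_nonneg (hnonneg i y) hc) hs.summable,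
      hs.tsum_eq, ← ENNReal.ofReal_mul (inv_nonneg.2 hδ.le),
      Real.rpow_one_add' (hGnonneg y) (by positivity)]
    congr 1
    ring
  calc ∑' i, ∫⁻ y, ENNReal.ofReal (g i y * max (Real.log (g i y)) 0)
      ≤ ∑' i, ∫⁻ y, ENNReal.ofReal (g i y * (G y ^ δ / δ)) :=
        ENNReal.tsum_le_tsum fun i =>
          MeasureTheory.lintegral_mono fun y => ENNReal.ofReal_le_ofReal (hle i y)
    _ = ∫⁻ y, ∑' i, ENNReal.ofReal (g i y * (G y ^ δ / δ)) :=
        (MeasureTheory.lintegral_tsum fun i =>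
          ((hmeas i).mul ((hGmeas.pow_const δ).div_const δ)).ennreal_ofReal.aemeasurable).symm
    _ = ENNReal.ofReal δ⁻¹ * ∫⁻ y, ENNReal.ofReal (G y ^ (1 + δ)) := by
        simp_rw [hsum]
        exact MeasureTheory.lintegral_const_mul _ (hGmeas.pow_const _).ennreal_ofReal
    _ < ⊤ := ENNReal.mul_lt_top ENNReal.ofReal_lt_top hfin
end

section
/- Let (Z_1, Z_2) be a pair of mixed-pair random variables with joint density functions g_{x_1,x_2}(y_1,y_2) indexed by pairs (x_1,x_2) in the countable support of the discrete parts, and marginal density functions g_{x_1}(y_1) = ∑_{x_2} ∫_ℝ g_{x_1,x_2}(y_1,y_2) dy_2 and g_{x_2}(y_2) = ∑_{x_1} ∫_ℝ g_{x_1,x_2}(y_1,y_2) dy_1. Assuming the joint pair and both marginals are good mixed-pairs, the mutual information I(Z_1; Z_2) = ∑_{x_1,x_2} ∫_{ℝ^2} g_{x_1,x_2}(y_1,y_2) log [ g_{x_1,x_2}(y_1,y_2) / (g_{x_1}(y_1) g_{x_2}(y_2)) ] dy_1 dy_2 is nonnegative; equivalently, H(Z_1,Z_2) ≤ H(Z_1)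 + H(Z_2). -/
open MeasureTheory Measure

section CountingProduct

variable {α : Type*} [MeasurableSpace α]

lemma lintegral_count_prod {ν : Measure α} [SFinite ν] {f : ℕ × α → ENNReal} (hf : Measurable f) :
    ∫⁻ z, f z ∂(count.prod ν) = ∑' i, ∫⁻ y, f (i, y) ∂ν := by
  rw [lintegral_prod _ hf.aemeasurable, lintegral_count]

lemma integral_count_prod {ν : Measure α} [SFinite ν] {f : ℕ × α → ℝ}
    (hf : Integrable f (count.prod ν)) :
    ∫ z, f z ∂(count.prod ν) = ∑' i, ∫ y, f (i, y) ∂ν := by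
  rw [integral_prod _ hf, integral_countable hf.integral_prod_left]
  simp [measureReal_def]

lemma integrable_count_prod_slice {ν : Measure α} [SFinite ν] {f : ℕ × α → ℝ}
    (hf : Integrable f (count.prod ν)) (i : ℕ) : Integrable (fun y => f (i, y)) ν :=
  ae_count_iff.mp hf.prod_right_ae i

lemma integrable_of_lintegral_ofReal_abs_lt_top {μ : Measure α} {f : α → ℝ} (hf : Measurable f)
    (h : ∫⁻ z, ENNReal.ofReal |f z| ∂μ < ⊤) : Integrable f μ := by
  refine ⟨hf.aestronglyMeasurable, ?_⟩
  rw [hasFiniteIntegral_iff_norm]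
  simpa [Real.norm_eq_abs] using h

lemma measurePreserving_mixedShuffle :
    MeasurePreserving (fun w : (ℕ × ℝ) × (ℕ × ℝ) => (w.1.1, w.2.1, w.1.2, w.2.2))
      (((count : Measure ℕ).prod volume).prod ((count : Measure ℕ).prod volume))
      ((count : Measure ℕ).prod ((count : Measure ℕ).prod (volume : Measure (ℝ × ℝ)))) := by
  have h1 := measurePreserving_prodAssoc (count : Measure ℕ) (volume : Measure ℝ)
    ((count : Measure ℕ).prod (volume : Measure ℝ))
  have h2 := (measurePreserving_prodAssoc (volume : Measure ℝ) (count : Measure ℕ)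
    (volume : Measure ℝ)).symm
  have h3 := (measurePreserving_swap (μ := (volume : Measure ℝ)) (ν := (count : Measure ℕ))).prod
    (MeasurePreserving.id (volume : Measure ℝ))
  have h4 := measurePreserving_prodAssoc (count : Measure ℕ) (volume : Measure ℝ)
    (volume : Measure ℝ)
  exact ((MeasurePreserving.id (count : Measure ℕ)).prod (h4.comp (h3.comp h2))).comp h1

/-- The family `f i j` as one function of two mixed variables. -/
def mixedJoin (f : ℕ → ℕ → ℝ × ℝ → ℝ) (w : (ℕ × ℝ) × (ℕ × ℝ)) : ℝ :=
  f w.1.1 w.2.1 (w.1.2, w.2.2)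

variable {f : ℕ → ℕ → ℝ × ℝ → ℝ}

lemma measurable_uncurried (hf : ∀ i j, Measurable (f i j)) :
    Measurable fun p : ℕ × ℕ × ℝ × ℝ => f p.1 p.2.1 p.2.2 :=
  measurable_from_prod_countable_right fun i => measurable_from_prod_countable_right fun j => hf i j

lemma measurable_mixedJoin (hf : ∀ i j, Measurable (f i j)) : Measurable (mixedJoin f) :=
  (measurable_uncurried hf).comp measurePreserving_mixedShuffle.measurable

lemma lintegral_mixedJoin (hf : ∀ i j, Measurable (f i j)) {φ : ℝ → ENNReal} (hφ : Measurable φ) :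
    ∫⁻ w, φ (mixedJoin f w) ∂((count.prod volume).prod (count.prod volume))
      = ∑' i, ∑' j, ∫⁻ z, φ (f i j z) := by
  have hm := hφ.comp (measurable_uncurried hf)
  refine (measurePreserving_mixedShuffle.lintegral_comp hm).trans ?_
  rw [lintegral_count_prod hm]
  refine tsum_congr fun i => ?_
  exact lintegral_count_prod (hm.comp measurable_prodMk_left)

lemma integral_mixedJoin (hf : ∀ i j, Measurable (f i j))
    (hint : Integrable (mixedJoin f) ((count.prod volume).prod (count.prod volume))) :
    ∫ w, mixedJoin f w ∂((count.prod volume).prod (count.prod volume))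
      = ∑' i, ∑' j, ∫ z, f i j z := by
  have hm := measurable_uncurried hf
  have hi : Integrable (fun p : ℕ × ℕ × ℝ × ℝ => f p.1 p.2.1 p.2.2)
      (count.prod (count.prod volume)) :=
    (measurePreserving_mixedShuffle.integrable_comp hm.aestronglyMeasurable).mp hint
  have h := integral_map measurePreserving_mixedShuffle.aemeasurable
    (f := fun p : ℕ × ℕ × ℝ × ℝ => f p.1 p.2.1 p.2.2) hm.aestronglyMeasurable
  rw [measurePreserving_mixedShuffle.map_eq] at h
  refine h.symm.trans ?_
  rw [integral_count_prod hi]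
  exact tsum_congr fun i => integral_count_prod (integrable_count_prod_slice hi i)

end CountingProduct

section Marginals

variable {α β : Type*} [MeasurableSpace α] [MeasurableSpace β] {μ : Measure α} {ν : Measure β}
  [SigmaFinite μ] [SigmaFinite ν] {q : α × β → ℝ}

lemma measurable_marginal (hm : Measurable q) : Measurable fun x => ∫ y, q (x, y) ∂ν :=
  (hm.stronglyMeasurable.integral_prod_right' (ν := ν)).measurable

lemma integrable_mul_comp_fst (hq : Integrable q (μ.prod ν)) (h0 : ∀ z, 0 ≤ q z) {h : α → ℝ}
    (hh : Measurable h) (hi : Integrable (fun x => (∫ y, q (x, y) ∂ν) * h x) μ) :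
    Integrable (fun z : α × β => q z * h z.1) (μ.prod ν) := by
  have hs : AEStronglyMeasurable (fun z : α × β => q z * h z.1) (μ.prod ν) :=
    hq.aestronglyMeasurable.mul (hh.comp measurable_fst).aestronglyMeasurable
  rw [integrable_prod_iff hs]
  refine ⟨hq.prod_right_ae.mono fun x hx => hx.mul_const (h x), hi.norm.congr (.of_forall fun x => ?_)⟩
  simp only [norm_mul, integral_mul_const, Real.norm_eq_abs, abs_of_nonneg (h0 _)]
  rw [abs_of_nonneg (integral_nonneg fun y => h0 _)]

lemma integral_mul_comp_fst {h : α → ℝ}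
    (hi : Integrable (fun z : α × β => q z * h z.1) (μ.prod ν)) :
    ∫ z, q z * h z.1 ∂(μ.prod ν) = ∫ x, (∫ y, q (x, y) ∂ν) * h x ∂μ := by
  simp only [integral_prod _ hi, integral_mul_const]

lemma ae_eq_zero_of_marginal_eq_zero (hm : Measurable q) (hq : Integrable q (μ.prod ν))
    (h0 : ∀ z, 0 ≤ q z) : ∀ᵐ z ∂(μ.prod ν), ∫ y, q (z.1, y) ∂ν = 0 → q z = 0 := by
  have hA : Measurable fun z : α × β => ∫ y, q (z.1, y) ∂ν :=
    (measurable_marginal hm).comp measurable_fst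
  rw [ae_prod_iff_ae_ae]
  · filter_upwards [hq.prod_right_ae] with x hx
    by_cases ha : ∫ y, q (x, y) ∂ν = 0
    · filter_upwards [(integral_eq_zero_iff_of_nonneg (fun y => h0 (x, y)) hx).mp ha] with y hy _
      exact hy
    · exact .of_forall fun y hy => absurd hy ha
  · exact (measurableSet_eq_fun hA measurable_const).imp (measurableSet_eq_fun hm measurable_const)

lemma sub_mul_le_mul_log_sub {t a b : ℝ} (ht : 0 ≤ t) (ha : 0 ≤ a) (hb : 0 ≤ b)
    (hat : a = 0 → t = 0) (hbt : b = 0 → t = 0) :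
    t - a * b ≤ t * Real.log t - (t * Real.log a + t * Real.log b) := by
  rcases ht.eq_or_lt with rfl | ht
  · simpa using mul_nonneg ha hb
  have ha : 0 < a := ha.lt_of_ne fun h => ht.ne' (hat h.symm)
  have hb : 0 < b := hb.lt_of_ne fun h => ht.ne' (hbt h.symm)
  have h := Real.log_le_sub_one_of_pos (div_pos (mul_pos ha hb) ht)
  rw [Real.log_div (mul_pos ha hb).ne' ht.ne', Real.log_mul ha.ne' hb.ne'] at h
  have h2 := mul_le_mul_of_nonneg_left h ht.le
  have h3 : t * (a * b / t - 1) = a * b - t := by field_simp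
  linarith

/-- Subadditivity of differential entropy on a product of two σ-finite measure spaces. -/
theorem integral_marginal_mul_log_add_le (hm : Measurable q) (h0 : ∀ z, 0 ≤ q z)
    (hq : Integrable q (μ.prod ν)) (h1 : ∫ z, q z ∂(μ.prod ν) = 1)
    (hlog : Integrable (fun z => q z * Real.log (q z)) (μ.prod ν))
    (hlog₁ : Integrable (fun x => (∫ y, q (x, y) ∂ν) * Real.log (∫ y, q (x, y) ∂ν)) μ)
    (hlog₂ : Integrable (fun y => (∫ x, q (x, y) ∂μ) * Real.log (∫ x, q (x, y) ∂μ)) ν) :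
    ∫ x, (∫ y, q (x, y) ∂ν) * Real.log (∫ y, q (x, y) ∂ν) ∂μ
      + ∫ y, (∫ x, q (x, y) ∂μ) * Real.log (∫ x, q (x, y) ∂μ) ∂ν
      ≤ ∫ z, q z * Real.log (q z) ∂(μ.prod ν) := by
  have hms : Measurable (q ∘ Prod.swap) := hm.comp measurable_swap
  have hA := integrable_mul_comp_fst hq h0 (measurable_marginal hm).log hlog₁
  have hB' := integrable_mul_comp_fst (q := q ∘ Prod.swap) hq.swap (fun z => h0 _)
    (measurable_marginal hms).log hlog₂
  have hB := hB'.swap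
  have hzero₁ := ae_eq_zero_of_marginal_eq_zero hm hq h0
  have hzero₂ := (measurePreserving_swap (μ := μ) (ν := ν)).quasiMeasurePreserving.ae
    (ae_eq_zero_of_marginal_eq_zero (q := q ∘ Prod.swap) hms hq.swap fun z => h0 _)
  have hab : Integrable (fun z : α × β => (∫ y, q (z.1, y) ∂ν) * ∫ x, q (x, z.2) ∂μ) (μ.prod ν) :=
    hq.integral_prod_left.mul_prod hq.integral_prod_right
  have hle := integral_mono_ae (hq.sub hab) (hlog.sub (hA.add hB)) <| by
    filter_upwards [hzero₁, hzero₂] with z hz₁ hz₂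
    exact sub_mul_le_mul_log_sub (h0 z) (integral_nonneg fun y => h0 _)
      (integral_nonneg fun x => h0 _) hz₁ hz₂
  rw [integral_sub' hq hab, integral_sub' hlog (hA.add hB), integral_add' hA hB, h1,
    integral_prod_mul (fun x => ∫ y, q (x, y) ∂ν) (fun y => ∫ x, q (x, y) ∂μ),
    ← integral_prod _ hq, ← integral_prod_symm _ hq, h1,
    integral_mul_comp_fst (h := fun x => Real.log (∫ y, q (x, y) ∂ν)) hA] at hle
  have hswap : ∫ z, _ ∂(μ.prod ν) = ∫ z, _ ∂(ν.prod μ) :=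
    integral_prod_swap (μ := ν) (ν := μ)
      (fun z : β × α => (q ∘ Prod.swap) z * Real.log (∫ x, (q ∘ Prod.swap) (z.1, x) ∂μ))
  have hB2 := hswap.trans (integral_mul_comp_fst (q := q ∘ Prod.swap)
    (h := fun y => Real.log (∫ x, (q ∘ Prod.swap) (y, x) ∂μ)) hB')
  simp only [Function.comp_def, Prod.swap_prod_mk, Prod.fst_swap, Prod.swap_swap] at hB2 hle
  linarith

end Marginals

section Mixed

variable {a : ℕ × ℝ → ℝ} {g : ℕ → ℝ → ℝ}

lemma integrable_mul_log_of_slices (ha : Measurable a)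
    (hag : ∀ i, g i =ᵐ[volume] fun y => a (i, y))
    (hgood : ∑' i, ∫⁻ y, ENNReal.ofReal |g i y * Real.log (g i y)| < ⊤) :
    Integrable (fun x => a x * Real.log (a x)) (count.prod volume) := by
  have hm : Measurable fun x => a x * Real.log (a x) := ha.mul ha.log
  refine integrable_of_lintegral_ofReal_abs_lt_top hm ?_
  rw [lintegral_count_prod (by fun_prop)]
  refine lt_of_eq_of_lt (tsum_congr fun i => lintegral_congr_ae ?_) hgood
  filter_upwards [hag i] with y hy
  rw [hy]

lemma integral_mul_log_eq_tsum_slices (hag : ∀ i, g i =ᵐ[volume] fun y => a (i, y))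
    (hint : Integrable (fun x => a x * Real.log (a x)) (count.prod volume)) :
    ∫ x, a x * Real.log (a x) ∂(count.prod volume) = ∑' i, ∫ y, g i y * Real.log (g i y) := by
  rw [integral_count_prod hint]
  refine tsum_congr fun i => integral_congr_ae ?_
  filter_upwards [hag i] with y hy
  rw [hy]

end Mixed


/- STATEMENT 4: For a pair (Z₁, Z₂) of mixed-pair random variables with joint
densities q_{i,j}(y₁,y₂) and marginal mixed-pair densities g₁ and g₂, assuming the
joint pair and both marginals are good, the mutual information
I(Z₁;Z₂) = H(Z₁) + H(Z₂) − H(Z₁,Z₂) is nonnegative; equivalently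
H(Z₁,Z₂) ≤ H(Z₁) + H(Z₂). -/
theorem mixed_pair_mutual_information_nonneg
    (q : ℕ → ℕ → ℝ × ℝ → ℝ) (g1 g2 : ℕ → ℝ → ℝ)
    (hqmeas : ∀ i j, Measurable (q i j))
    (hqnonneg : ∀ i j z, 0 ≤ q i j z)
    (htotal : ∑' i, ∑' j, ∫⁻ z, ENNReal.ofReal (q i j z) = 1)
    (hg1 : ∀ i y₁, g1 i y₁ = ∑' j, ∫ y₂, q i j (y₁, y₂))
    (hg2 : ∀ j y₂, g2 j y₂ = ∑' i, ∫ y₁, q i j (y₁, y₂))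
    (hgood : ∑' i, ∑' j, ∫⁻ z, ENNReal.ofReal |q i j z * Real.log (q i j z)| < ⊤)
    (hgood1 : ∑' i, ∫⁻ y, ENNReal.ofReal |g1 i y * Real.log (g1 i y)| < ⊤)
    (hgood2 : ∑' j, ∫⁻ y, ENNReal.ofReal |g2 j y * Real.log (g2 j y)| < ⊤) :
    0 ≤ (-∑' i, ∫ y, g1 i y * Real.log (g1 i y))
        + (-∑' j, ∫ y, g2 j y * Real.log (g2 j y))
        - (-∑' i, ∑' j, ∫ z, q i j z * Real.log (q i j z)) := by
  set Q := mixedJoin q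
  have hmQ : Measurable Q := measurable_mixedJoin hqmeas
  have hQ0 : ∀ w, 0 ≤ Q w := fun w => hqnonneg _ _ _
  have hlint : ∫⁻ w, ENNReal.ofReal (Q w) ∂((count.prod volume).prod (count.prod volume)) = 1 :=
    (lintegral_mixedJoin hqmeas ENNReal.measurable_ofReal).trans htotal
  have hQi : Integrable Q ((count.prod volume).prod (count.prod volume)) :=
    integrable_of_lintegral_ofReal_abs_lt_top hmQ <| by
      simp only [abs_of_nonneg (hQ0 _), hlint, ENNReal.one_lt_top]
  have hQ1 : ∫ w, Q w ∂((count.prod volume).prod (count.prod volume)) = 1 := by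
    rw [integral_eq_lintegral_of_nonneg_ae (.of_forall hQ0) hmQ.aestronglyMeasurable, hlint,
      ENNReal.toReal_one]
  have hqlog : ∀ i j, Measurable fun z => q i j z * Real.log (q i j z) :=
    fun i j => (hqmeas i j).mul (hqmeas i j).log
  have hlog : Integrable (mixedJoin fun i j z => q i j z * Real.log (q i j z))
      ((count.prod volume).prod (count.prod volume)) :=
    integrable_of_lintegral_ofReal_abs_lt_top (measurable_mixedJoin hqlog) <|
      (lintegral_mixedJoin hqlog (φ := fun t => ENNReal.ofReal |t|) (by fun_prop)).trans_lt hgood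
  have hag₁ : ∀ i, g1 i =ᵐ[volume] fun y => ∫ v, Q ((i, y), v) ∂(count.prod volume) := by
    intro i
    have h := ae_count_iff.mp (ae_ae_of_ae_prod hQi.prod_right_ae) i
    filter_upwards [h] with y hy
    rw [hg1, integral_count_prod hy]
    rfl
  have hag₂ : ∀ j, g2 j =ᵐ[volume] fun y => ∫ u, Q (u, (j, y)) ∂(count.prod volume) := by
    intro j
    have h := ae_count_iff.mp (ae_ae_of_ae_prod hQi.prod_left_ae) j
    filter_upwards [h] with y hy
    rw [hg2, integral_count_prod hy]
    rfl
  have hi₁ := integrable_mul_log_of_slices (measurable_marginal hmQ) hag₁ hgood1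
  have hi₂ := integrable_mul_log_of_slices
    (measurable_marginal (hmQ.comp measurable_swap)) hag₂ hgood2
  have h := integral_marginal_mul_log_add_le hmQ hQ0 hQi hQ1 hlog hi₁ hi₂
  have e₁ := integral_mul_log_eq_tsum_slices hag₁ hi₁
  have e₂ := integral_mul_log_eq_tsum_slices hag₂ hi₂
  have e : ∫ w, Q w * Real.log (Q w) ∂((count.prod volume).prod (count.prod volume)) = _ :=
    integral_mixedJoin hqlog hlog
  simp only [Function.comp_apply, Prod.swap_prod_mk] at e₂
  linarith
end

section
/- Let Z_1 = (X_1,Y_1) be a good mixed-pair random variable whose discrete part has countable support S_1 ⊂ ℝ, and let F : S_1 × ℝ → S_2 × ℝ be a bijection onto S_2 × ℝ (S_2 countable), continuous and differentiable in the second coordinate, with projections F_d : S_1 × ℝ → S_2 and F_c : S_1 × ℝ → ℝ. Let Z_2 = F(Z_1) be the induced mixed-pair random variable (i.e., the law of Z_2 is the pushforward of the law of Z_1 under F), and suppose Z_2 is also a good mixed-pair. If |d F_c(x_1, y_1)/d y_1| = 1 for all points (x_1, y_1) ∈ S_1 × ℝ, then H(Z_1) = H(Z_2). -/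
open MeasureTheory in
/-- A differentiable real function whose derivative has absolute value `1` everywhere is a
measure-preserving measurable equivalence of the line. -/
theorem exists_measurableEquiv_of_abs_deriv_eq_one {f : ℝ → ℝ} (hf : Differentiable ℝ f)
    (hf' : ∀ y, |deriv f y| = 1) :
    ∃ e : ℝ ≃ᵐ ℝ, MeasurePreserving e volume volume ∧ ∀ y, e y = f y := by
  have hsign : (∀ y, deriv f y = -1) ∨ ∀ y, deriv f y = 1 := by
    have hne : ∀ y ∈ (Set.univ : Set ℝ), deriv f y ≠ 0 := fun y _ h0 => by
      simpa [h0] using hf' y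
    rcases hasDerivWithinAt_forall_lt_or_forall_gt_of_forall_ne convex_univ
      (fun y _ => (hf y).hasDerivAt.hasDerivWithinAt) hne with hlt | hgt
    · left
      intro y
      have h1 := hf' y
      rw [abs_of_neg (hlt y trivial)] at h1
      linarith
    · right
      intro y
      have h1 := hf' y
      rwa [abs_of_pos (hgt y trivial)] at h1
  rcases hsign with hneg | hpos
  · refine ⟨(MeasurableEquiv.neg ℝ).trans (MeasurableEquiv.addRight (f 0)),
      (measurePreserving_add_right volume (f 0)).comp (Measure.measurePreserving_neg volume), ?_⟩
    intro y
    have hconst := is_const_of_deriv_eq_zero (hf.add differentiable_id) (fun z => by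
      rw [deriv_add (hf z) differentiableAt_id, hneg z, deriv_id]
      norm_num) y 0
    simp only [Pi.add_apply, id] at hconst
    change -y + f 0 = f y
    linarith
  · refine ⟨MeasurableEquiv.addRight (f 0), measurePreserving_add_right volume (f 0), ?_⟩
    intro y
    have hconst := is_const_of_deriv_eq_zero (hf.sub differentiable_id) (fun z => by
      rw [deriv_sub (hf z) differentiableAt_id, hpos z, deriv_id]
      norm_num) y 0
    simp only [Pi.sub_apply, id] at hconst
    change y + f 0 = f y
    linarith

open MeasureTheory in
/-- Two nonnegative densities intertwined by a measure-preserving equivalence agree almost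
everywhere after composition. -/
theorem ae_eq_comp_of_setLIntegral_preimage_eq {α β : Type*} [MeasurableSpace α]
    [MeasurableSpace β] {μ : Measure α} {ν : Measure β} [SigmaFinite μ] (e : α ≃ᵐ β)
    (he : MeasurePreserving e μ ν)
    {g : α → ℝ} {h : β → ℝ} (hg : Measurable g) (hh : Measurable h)
    (hg0 : ∀ x, 0 ≤ g x) (hh0 : ∀ y, 0 ≤ h y)
    (hgh : ∀ A, MeasurableSet A →
      ∫⁻ x in e ⁻¹' A, ENNReal.ofReal (g x) ∂μ = ∫⁻ y in A, ENNReal.ofReal (h y) ∂ν) :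
    g =ᵐ[μ] h ∘ e := by
  have hae : (fun x => ENNReal.ofReal (g x)) =ᵐ[μ] fun x => ENNReal.ofReal (h (e x)) := by
    refine ae_eq_of_forall_setLIntegral_eq_of_sigmaFinite hg.ennreal_ofReal
      (hh.comp e.measurable).ennreal_ofReal fun B hB _ => ?_
    have hpre : e ⁻¹' (e.symm ⁻¹' B) = B := by
      ext x
      simp
    have h1 := hgh _ (e.symm.measurable hB)
    rw [← he.setLIntegral_comp_preimage_emb e.measurableEmbedding] at h1
    rwa [hpre] at h1
  filter_upwards [hae] with x hx
  exact (ENNReal.ofReal_eq_ofReal_iff (hg0 x) (hh0 _)).1 hx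


/- STATEMENT 5: Entropy preservation under bijections of mixed-pair random variables.
If Z₁ is a good mixed-pair with law μ and densities g, F is a bijection of the
(countable support) × ℝ spaces which is continuous and differentiable in the real
coordinate, Z₂ = F(Z₁) is the induced good mixed-pair with densities h, and the
derivative of the continuous projection F_c(x,·) has absolute value 1 everywhere,
then H(Z₁) = H(Z₂). -/
theorem mixed_pair_entropy_preserved_under_bijection
    {S₁ S₂ : Type*} [Countable S₁] [Countable S₂]
    [MeasurableSpace S₁] [TopologicalSpace S₂] [DiscreteTopology S₂]
    (μ : MeasureTheory.Measure (S₁ × ℝ))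
    (F : S₁ × ℝ → S₂ × ℝ)
    (hFbij : Function.Bijective F)
    (hFcont : ∀ x₁, Continuous (fun y₁ => F (x₁, y₁)))
    (hFdiff : ∀ x₁, Differentiable ℝ (fun y₁ => (F (x₁, y₁)).2))
    (g : S₁ → ℝ → ℝ) (h : S₂ → ℝ → ℝ)
    (hgmeas : ∀ i, Measurable (g i)) (hgnonneg : ∀ i y, 0 ≤ g i y)
    (hhmeas : ∀ j, Measurable (h j)) (hhnonneg : ∀ j y, 0 ≤ h j y)
    (hμ : ∀ (i : S₁) (A : Set ℝ), MeasurableSet A →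
      μ ({i} ×ˢ A) = ∫⁻ y in A, ENNReal.ofReal (g i y))
    (hν : ∀ (j : S₂) (A : Set ℝ), MeasurableSet A →
      μ (F ⁻¹' ({j} ×ˢ A)) = ∫⁻ y in A, ENNReal.ofReal (h j y))
    (htotal : ∑' i, ∫⁻ y, ENNReal.ofReal (g i y) = 1)
    (hgood₁ : ∑' i, ∫⁻ y, ENNReal.ofReal |g i y * Real.log (g i y)| < ⊤)
    (hgood₂ : ∑' j, ∫⁻ y, ENNReal.ofReal |h j y * Real.log (h j y)| < ⊤)
    (hderiv : ∀ x₁ y₁, |deriv (fun y => (F (x₁, y)).2) y₁| = 1) :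
    (-∑' i, ∫ y, g i y * Real.log (g i y)) = -∑' j, ∫ y, h j y * Real.log (h j y) := by
  choose e he hef using fun i => exists_measurableEquiv_of_abs_deriv_eq_one (hFdiff i) (hderiv i)
  let σ : S₁ → S₂ := fun i => (F (i, 0)).1
  have hF : ∀ i y, F (i, y) = (σ i, e i y) := fun i y =>
    Prod.ext (PreconnectedSpace.constant inferInstance (continuous_fst.comp (hFcont i)))
      (hef i y).symm
  have hσbij : Function.Bijective σ := by
    refine ⟨fun i i' hii => ?_, fun j => ?_⟩
    · have hFF : F (i, 0) = F (i', (e i').symm (e i 0)) := by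
        rw [hF, hF, hii, MeasurableEquiv.apply_symm_apply]
      exact congrArg Prod.fst (hFbij.1 hFF)
    · obtain ⟨⟨i, y⟩, hy⟩ := hFbij.2 (j, 0)
      rw [hF] at hy
      exact ⟨i, congrArg Prod.fst hy⟩
  have hpre : ∀ i A, F ⁻¹' ({σ i} ×ˢ A) = {i} ×ˢ (e i ⁻¹' A) := by
    rintro i A
    ext ⟨k, y⟩
    simp only [Set.mem_preimage, hF, Set.mem_prod, Set.mem_singleton_iff, hσbij.1.eq_iff]
    constructor <;> rintro ⟨rfl, hy⟩ <;> exact ⟨rfl, hy⟩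
  congr 1
  rw [← (Equiv.ofBijective σ hσbij).tsum_eq]
  refine tsum_congr fun i => ?_
  have hae := ae_eq_comp_of_setLIntegral_preimage_eq (e i) (he i) (hgmeas i) (hhmeas (σ i))
    (hgnonneg i) (hhnonneg (σ i)) fun A hA => by
      rw [← hν _ A hA, hpre, hμ i _ ((e i).measurable hA)]
  rw [Equiv.ofBijective_apply, ← (he i).integral_comp (e i).measurableEmbedding
    fun z => h (σ i) z * Real.log (h (σ i) z)]
  refine MeasureTheory.integral_congr_ae ?_
  filter_upwards [hae] with y hy
  rw [hy, Function.comp_apply]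
end

section
/- Let Z^1 = (X^1, Y^1) be a good vector of mixed-pair random variables whose discrete part has countable support S_1 ⊂ ℝ^d, and let F : S_1 × ℝ^d → S_2 × ℝ^d be a bijection onto S_2 × ℝ^d (S_2 countable in ℝ^d), continuous and differentiable in the ℝ^d coordinate, with projections F_d : S_1 × ℝ^d → S_2 and F_c : S_1 × ℝ^d → ℝ^d. Let Z^2 = F(Z^1) be the induced vector of mixed-pairs (the law of Z^2 is the pushforward of the law of Z^1 under F), and suppose Z^2 is also good. If for every (x, y) ∈ S_1 × ℝ^d the Jacobian matrix J(x,y) of the map y ↦ F_c(x,y) satisfies |det J(x,y)| = 1, then H(Z^1) = H(Z^2). -/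
open MeasureTheory

/-- If an injective differentiable map `f` has `|det f'| = 1` and carries the density `u` to the
density `v` on its range, then `u = v ∘ f` almost everywhere. -/
lemma ae_eq_comp_of_setLIntegral_image_eq {E : Type*} [NormedAddCommGroup E] [NormedSpace ℝ E]
    [FiniteDimensional ℝ E] [MeasureSpace E] [BorelSpace E]
    [(volume : Measure E).IsAddHaarMeasure] {f : E → E} {f' : E → E →L[ℝ] E}
    (hf : ∀ y, HasFDerivAt f (f' y) y) (hinj : f.Injective) (hdet : ∀ y, |(f' y).det| = 1)
    {u v : E → ℝ} (hu : Measurable u) (hv : Measurable v) (hu0 : ∀ y, 0 ≤ u y) (hv0 : ∀ y, 0 ≤ v y)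
    (huv : ∀ B, MeasurableSet B →
      ∫⁻ y in B, ENNReal.ofReal (u y) = ∫⁻ y in f '' B, ENNReal.ofReal (v y)) :
    u =ᵐ[volume] v ∘ f := by
  have hfm : Measurable f :=
    (continuous_iff_continuousAt.2 fun y => (hf y).continuousAt).measurable
  have key : (fun y => ENNReal.ofReal (u y)) =ᵐ[volume] fun y => ENNReal.ofReal (v (f y)) := by
    refine ae_eq_of_forall_setLIntegral_eq_of_sigmaFinite hu.ennreal_ofReal
      (hv.comp hfm).ennreal_ofReal fun B hB _ => ?_
    rw [huv B hB, lintegral_image_eq_lintegral_abs_det_fderiv_mul volume hB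
      (fun y _ => (hf y).hasFDerivWithinAt) hinj.injOn]
    simp [hdet]
  filter_upwards [key] with y hy
  exact (ENNReal.ofReal_eq_ofReal_iff (hu0 y) (hv0 _)).1 hy

/-- Integrability of every member of a family whose absolute integrals have a finite sum. -/
lemma integrable_of_tsum_lintegral_ofReal_abs_lt_top {ι α : Type*} [MeasurableSpace α]
    {m : Measure α} {f : ι → α → ℝ} (hf : ∀ i, Measurable (f i))
    (hfin : ∑' i, ∫⁻ y, ENNReal.ofReal |f i y| ∂m < ⊤) (i : ι) : Integrable (f i) m := by
  refine ⟨(hf i).aestronglyMeasurable, ?_⟩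
  rw [hasFiniteIntegral_iff_norm]
  exact (ENNReal.le_tsum i).trans_lt hfin

/-- The integrals of such a family are summable. -/
lemma summable_integral_of_tsum_lintegral_ofReal_abs_lt_top {ι α : Type*} [MeasurableSpace α]
    {m : Measure α} {f : ι → α → ℝ}
    (hfin : ∑' i, ∫⁻ y, ENNReal.ofReal |f i y| ∂m < ⊤) : Summable fun i => ∫ y, f i y ∂m := by
  refine Summable.of_norm_bounded (ENNReal.summable_toReal hfin.ne) fun i => ?_
  exact norm_integral_le_lintegral_norm (f i)

/- STATEMENT 6: Entropy preservation under bijections of vectors of mixed-pair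
random variables.  If Z¹ is a good mixed-pair vector with law μ and densities g,
F is a bijection of the (countable support) × ℝ^d spaces which is continuous and
differentiable in the ℝ^d coordinate, Z² = F(Z¹) is the induced good mixed-pair
vector with densities h, and the Jacobian of F_c(x,·) has |det| = 1 everywhere,
then H(Z¹) = H(Z²). -/
theorem mixed_pair_vector_entropy_preserved_under_bijection
    (d : ℕ) {S₁ S₂ : Type*} [Countable S₁] [Countable S₂]
    [MeasurableSpace S₁] [TopologicalSpace S₂] [DiscreteTopology S₂]
    (μ : MeasureTheory.Measure (S₁ × EuclideanSpace ℝ (Fin d)))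
    (F : S₁ × EuclideanSpace ℝ (Fin d) → S₂ × EuclideanSpace ℝ (Fin d))
    (hFbij : Function.Bijective F)
    (hFcont : ∀ x₁, Continuous (fun y₁ => F (x₁, y₁)))
    (hFdiff : ∀ x₁, Differentiable ℝ (fun y₁ => (F (x₁, y₁)).2))
    (g : S₁ → EuclideanSpace ℝ (Fin d) → ℝ) (h : S₂ → EuclideanSpace ℝ (Fin d) → ℝ)
    (hgmeas : ∀ i, Measurable (g i)) (hgnonneg : ∀ i y, 0 ≤ g i y)
    (hhmeas : ∀ j, Measurable (h j)) (hhnonneg : ∀ j y, 0 ≤ h j y)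
    (hμ : ∀ (i : S₁) (A : Set (EuclideanSpace ℝ (Fin d))), MeasurableSet A →
      μ ({i} ×ˢ A) = ∫⁻ y in A, ENNReal.ofReal (g i y))
    (hν : ∀ (j : S₂) (A : Set (EuclideanSpace ℝ (Fin d))), MeasurableSet A →
      μ (F ⁻¹' ({j} ×ˢ A)) = ∫⁻ y in A, ENNReal.ofReal (h j y))
    (htotal : ∑' i, ∫⁻ y, ENNReal.ofReal (g i y) = 1)
    (hgood₁ : ∑' i, ∫⁻ y, ENNReal.ofReal |g i y * Real.log (g i y)| < ⊤)
    (hgood₂ : ∑' j, ∫⁻ y, ENNReal.ofReal |h j y * Real.log (h j y)| < ⊤)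
    (hjac : ∀ x₁ y₁,
      |LinearMap.det (fderiv ℝ (fun y => (F (x₁, y)).2) y₁ :
        EuclideanSpace ℝ (Fin d) →ₗ[ℝ] EuclideanSpace ℝ (Fin d))| = 1) :
    (-∑' i, ∫ y, g i y * Real.log (g i y)) = -∑' j, ∫ y, h j y * Real.log (h j y) := by
  have hconst : ∀ i, ∃ j, ∀ y, (F (i, y)).1 = j := fun i =>
    ⟨(F (i, 0)).1, fun y => PreconnectedSpace.constant inferInstance
      (continuous_fst.comp (hFcont i)) (x := y) (y := 0)⟩
  choose σ hσ using hconst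
  let φ : S₁ → EuclideanSpace ℝ (Fin d) → EuclideanSpace ℝ (Fin d) := fun i y => (F (i, y)).2
  have hF : ∀ i y, F (i, y) = (σ i, φ i y) := fun i y => Prod.ext (hσ i y) rfl
  have hderiv : ∀ i y, HasFDerivAt (φ i) (fderiv ℝ (φ i) y) y := fun i y =>
    (hFdiff i y).hasFDerivAt
  have hsep : ∀ i i' y y', σ i = σ i' → φ i y = φ i' y' → i = i' ∧ y = y' := by
    intro i i' y y' h₁ h₂
    have := hFbij.1 (a₁ := (i, y)) (a₂ := (i', y')) (by rw [hF, hF, h₁, h₂])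
    exact Prod.ext_iff.1 this
  have hinj : ∀ i, (φ i).Injective := fun i y y' hy => (hsep i i y y' rfl hy).2
  have hemb : ∀ i, MeasurableEmbedding (φ i) := fun i =>
    (hFdiff i).continuous.measurableEmbedding (hinj i)
  have hdens : ∀ i, g i =ᵐ[volume] h (σ i) ∘ φ i := by
    intro i
    refine ae_eq_comp_of_setLIntegral_image_eq (hderiv i) (hinj i) (hjac i) (hgmeas i)
      (hhmeas _) (hgnonneg i) (hhnonneg _) fun B hB => ?_
    rw [← hμ i B hB, ← hν _ _ ((hemb i).measurableSet_image.2 hB)]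
    congr 1
    ext ⟨i', y⟩
    simp only [Set.mem_prod, Set.mem_singleton_iff, Set.mem_preimage, hF, Set.mem_image]
    constructor
    · rintro ⟨rfl, hy⟩
      exact ⟨rfl, y, hy, rfl⟩
    · rintro ⟨h₁, y', hy', h₂⟩
      obtain ⟨rfl, rfl⟩ := hsep _ _ _ _ h₁.symm h₂
      exact ⟨rfl, hy'⟩
  have hpiece : ∀ i, ∫ y, g i y * Real.log (g i y) =
      ∫ z in Set.range (φ i), h (σ i) z * Real.log (h (σ i) z) := by
    intro i
    rw [← Set.image_univ, integral_image_eq_integral_abs_det_fderiv_smul volume MeasurableSet.univ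
      (fun y _ => (hderiv i y).hasFDerivWithinAt) (hinj i).injOn, setIntegral_univ]
    refine integral_congr_ae ?_
    filter_upwards [hdens i] with y hy
    have hd : |(fderiv ℝ (φ i) y).det| = 1 := hjac i y
    rw [hd, one_smul, hy, Function.comp_apply]
  have hcover : ∀ j, ⋃ i : {i // σ i = j}, Set.range (φ i) = Set.univ := by
    intro j
    refine Set.eq_univ_of_forall fun z => ?_
    obtain ⟨⟨i, y⟩, hiy⟩ := hFbij.2 (j, z)
    rw [hF, Prod.mk.injEq] at hiy
    exact Set.mem_iUnion.2 ⟨⟨i, hiy.1⟩, y, hiy.2⟩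
  have hdisj : ∀ j, Pairwise (Function.onFun Disjoint
      fun i : {i // σ i = j} => Set.range (φ i)) := by
    rintro j ⟨i, hi⟩ ⟨i', hi'⟩ hne
    refine Set.disjoint_left.2 ?_
    rintro _ ⟨y, rfl⟩ ⟨y', hy'⟩
    exact hne (Subtype.ext (hsep i i' y y' (hi.trans hi'.symm) hy'.symm).1)
  have hint : ∀ j, Integrable (fun y => h j y * Real.log (h j y)) volume :=
    integrable_of_tsum_lintegral_ofReal_abs_lt_top
      (fun j => (hhmeas j).mul (hhmeas j).log) hgood₂
  have hsum := summable_integral_of_tsum_lintegral_ofReal_abs_lt_top hgood₁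
  congr 1
  rw [← (Equiv.sigmaFiberEquiv σ).tsum_eq]
  refine (((Equiv.sigmaFiberEquiv σ).summable_iff.2 hsum).tsum_sigma).trans
    (tsum_congr fun j => ?_)
  rw [← setIntegral_univ (μ := volume) (f := fun y => h j y * Real.log (h j y)), ← hcover j,
    integral_iUnion (fun i : {i // σ i = j} => (hemb i).measurableSet_range)
      (hdisj j) (hint j).integrableOn]
  refine tsum_congr ?_
  rintro ⟨i, rfl⟩
  exact hpiece i
end

section
/- Let λ > 0, let L ∈ ℝ, and let (h_k)_{k ≥ 0} be a sequence of real numbers such that h_k / k → L as k → ∞ and sup_{k ≥ 0} |h_k|/(k+1) < ∞. For T > 0 let N_T be a Poisson random variable with mean λT, i.e. P(N_T = k) = e^{−λT} (λT)^k / k!. Then (1/T) E[h_{N_T}] = (1/T) ∑_{k ≥ 0} h_k e^{−λT} (λT)^k / k! converges to λL as T → ∞. -/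
open Filter

lemma hasSum_poisson_weight (x : ℝ) :
    HasSum (fun k : ℕ => Real.exp (-x) * x ^ k / k.factorial) 1 := by
  have h := (NormedSpace.expSeries_div_hasSum_exp x).mul_left (Real.exp (-x))
  rw [← Real.exp_eq_exp_ℝ, ← Real.exp_add, neg_add_cancel, Real.exp_zero] at h
  simpa only [mul_div_assoc] using h

lemma poisson_weight_nonneg {x : ℝ} (hx : 0 ≤ x) (k : ℕ) :
    0 ≤ Real.exp (-x) * x ^ k / k.factorial := by positivity

lemma tendsto_poisson_weight (k : ℕ) :
    Tendsto (fun x : ℝ => Real.exp (-x) * x ^ k / k.factorial) atTop (nhds 0) := by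
  simpa [mul_comm] using
    (Real.tendsto_pow_mul_exp_neg_atTop_nhds_zero k).div_const (k.factorial : ℝ)

/-- A convergent sequence is summable against the Poisson weights. -/
lemma summable_mul_poisson_weight {a : ℕ → ℝ} {L : ℝ} (ha : Tendsto a atTop (nhds L)) (x : ℝ) :
    Summable (fun k : ℕ => a k * (Real.exp (-x) * x ^ k / k.factorial)) := by
  obtain ⟨M, hM⟩ := ha.norm.bddAbove_range
  refine Summable.of_norm_bounded ((hasSum_poisson_weight x).summable.norm.mul_left M) fun k => ?_
  rw [norm_mul]
  exact mul_le_mul_of_nonneg_right (hM ⟨k, rfl⟩) (norm_nonneg _)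

lemma tendsto_tsum_mul_poisson_weight_zero {a : ℕ → ℝ} (ha : Tendsto a atTop (nhds 0)) :
    Tendsto (fun x : ℝ => ∑' k : ℕ, a k * (Real.exp (-x) * x ^ k / k.factorial))
      atTop (nhds 0) := by
  rw [Metric.tendsto_nhds]
  intro ε hε
  obtain ⟨K, hK⟩ := Metric.tendsto_atTop.1 ha (ε / 2) (half_pos hε)
  have hfin : Tendsto (fun x : ℝ => ∑ k ∈ Finset.range K,
      |a k| * (Real.exp (-x) * x ^ k / k.factorial)) atTop (nhds 0) := by
    simpa using tendsto_finsetSum (Finset.range K)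
      fun k _ => (tendsto_poisson_weight k).const_mul |a k|
  filter_upwards [hfin.eventually_lt_const (half_pos hε), eventually_ge_atTop 0] with x hx hx0
  have hhead : HasSum (fun k : ℕ => if k ∈ Finset.range K then
      |a k| * (Real.exp (-x) * x ^ k / k.factorial) else 0) (∑ k ∈ Finset.range K,
      |a k| * (Real.exp (-x) * x ^ k / k.factorial)) := by
    rw [← Finset.sum_congr rfl fun k hk => if_pos hk]
    exact hasSum_sum_of_ne_finset_zero fun k hk => if_neg hk
  have hbound := tsum_of_norm_bounded (f := fun k : ℕ =>
    a k * (Real.exp (-x) * x ^ k / k.factorial))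
    (hhead.add ((hasSum_poisson_weight x).mul_left (ε / 2))) fun k => by
      have hp := poisson_weight_nonneg hx0 k
      rw [norm_mul, Real.norm_of_nonneg hp, Real.norm_eq_abs]
      split_ifs with hk
      · exact le_add_of_nonneg_right (by positivity)
      · rw [zero_add]
        have := hK k (by simpa using hk)
        rw [Real.dist_eq, sub_zero] at this
        exact mul_le_mul_of_nonneg_right this.le hp
  rw [dist_zero_right]
  linarith

/-- Poisson averages of a convergent sequence converge to its limit as the mean tends to
infinity. -/
lemma tendsto_tsum_mul_poisson_weight {a : ℕ → ℝ} {L : ℝ} (ha : Tendsto a atTop (nhds L)) :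
    Tendsto (fun x : ℝ => ∑' k : ℕ, a k * (Real.exp (-x) * x ^ k / k.factorial))
      atTop (nhds L) := by
  have h0 : Tendsto (fun k => a k - L) atTop (nhds 0) := by simpa using ha.sub_const L
  have h1 := (tendsto_tsum_mul_poisson_weight_zero h0).add_const L
  rw [zero_add] at h1
  refine h1.congr fun x => ?_
  have hL := (hasSum_poisson_weight x).mul_left L
  rw [mul_one] at hL
  simp only [sub_mul]
  rw [(summable_mul_poisson_weight ha x).tsum_sub hL.summable, hL.tsum_eq, sub_add_cancel]

/-- The size-bias identity for the Poisson distribution. -/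
lemma tsum_mul_poisson_weight_eq {h : ℕ → ℝ} {L : ℝ}
    (hL : Tendsto (fun k : ℕ => h (k + 1) / (k + 1 : ℝ)) atTop (nhds L)) (x : ℝ) :
    ∑' k : ℕ, h k * (Real.exp (-x) * x ^ k / k.factorial) =
      h 0 * Real.exp (-x) +
        x * ∑' k : ℕ, h (k + 1) / (k + 1 : ℝ) * (Real.exp (-x) * x ^ k / k.factorial) := by
  have hs := (summable_mul_poisson_weight hL x).mul_left x
  have hshift : ∀ k : ℕ,
      x * (h (k + 1) / (k + 1 : ℝ) * (Real.exp (-x) * x ^ k / k.factorial)) =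
        h (k + 1) * (Real.exp (-x) * x ^ (k + 1) / (k + 1).factorial) := fun k => by
    rw [Nat.factorial_succ]
    push_cast
    field_simp
    ring
  have hsum : Summable fun k : ℕ => h k * (Real.exp (-x) * x ^ k / k.factorial) :=
    (summable_nat_add_iff (f := fun k : ℕ => h k * (Real.exp (-x) * x ^ k / k.factorial)) 1).1
      (hs.congr hshift)
  rw [hsum.tsum_eq_zero_add, ← tsum_mul_left, tsum_congr hshift, pow_zero, Nat.factorial_zero,
    Nat.cast_one, mul_one, div_one]

/- STATEMENT 10: If h_k / k → L and sup_k |h_k|/(k+1) < ∞, and N_T is Poisson with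
mean λT, then (1/T) E[h_{N_T}] → λ L as T → ∞. -/
theorem poisson_average_tendsto
    (lam : ℝ) (hlam : 0 < lam) (L : ℝ) (h : ℕ → ℝ)
    (hL : Tendsto (fun k : ℕ => h k / k) atTop (nhds L))
    (hbdd : ∃ C : ℝ, ∀ k : ℕ, |h k| / (k + 1) ≤ C) :
    Tendsto
      (fun T : ℝ =>
        (1 / T) * ∑' k : ℕ, h k * (Real.exp (-(lam * T)) * (lam * T) ^ k / k.factorial))
      atTop (nhds (lam * L)) := by
  have hg : Tendsto (fun k : ℕ => h (k + 1) / (k + 1 : ℝ)) atTop (nhds L) := by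
    simpa using (tendsto_add_atTop_iff_nat 1).2 hL
  have hmean : Tendsto (fun T : ℝ => lam * T) atTop atTop := tendsto_id.const_mul_atTop hlam
  have hexp : Tendsto (fun T : ℝ => Real.exp (-(lam * T))) atTop (nhds 0) :=
    Real.tendsto_exp_neg_atTop_nhds_zero.comp hmean
  have hmain := (tendsto_inv_atTop_zero.mul (hexp.const_mul (h 0))).add
    (((tendsto_tsum_mul_poisson_weight hg).comp hmean).const_mul lam)
  rw [zero_mul, zero_add] at hmain
  refine hmain.congr' ?_
  filter_upwards [eventually_gt_atTop 0] with T hT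
  rw [tsum_mul_poisson_weight_eq hg, Function.comp_apply]
  field_simp
end

section
/- Let N be a Poisson random variable with mean μ > 0. Then for every nonnegative integer k with k ≤ μ/2, P(N ≤ k) ≤ exp(−μ/8). -/
/-- Chernoff-type bound for the partial sums of the exponential series. -/
theorem sum_range_succ_pow_div_factorial_le {x s : ℝ} (hx : 0 ≤ x) (hs : 1 ≤ s) (k : ℕ) :
    ∑ j ∈ Finset.range (k + 1), x ^ j / j.factorial ≤ s ^ k * Real.exp (x / s) := by
  have hs0 : 0 < s := by linarith
  calc ∑ j ∈ Finset.range (k + 1), x ^ j / j.factorial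
      ≤ ∑ j ∈ Finset.range (k + 1), s ^ k * ((x / s) ^ j / j.factorial) := by
        refine Finset.sum_le_sum fun j hj => ?_
        have hjk : j ≤ k := Nat.lt_succ_iff.mp (Finset.mem_range.mp hj)
        calc x ^ j / j.factorial = s ^ j * ((x / s) ^ j / j.factorial) := by
              rw [div_pow]; field_simp
          _ ≤ s ^ k * ((x / s) ^ j / j.factorial) := by gcongr
    _ = s ^ k * ∑ j ∈ Finset.range (k + 1), (x / s) ^ j / j.factorial := by
        rw [Finset.mul_sum]
    _ ≤ s ^ k * Real.exp (x / s) := by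
        gcongr
        exact Real.sum_le_exp_of_nonneg (by positivity) _

/- STATEMENT 11: Poisson tail bound: if N is Poisson with mean μ > 0 and k ≤ μ/2,
then P(N ≤ k) ≤ exp(−μ/8). -/
theorem poisson_lower_tail_bound
    (μ : ℝ) (hμ : 0 < μ) (k : ℕ) (hk : (k : ℝ) ≤ μ / 2) :
    ∑ j ∈ Finset.range (k + 1), Real.exp (-μ) * μ ^ j / j.factorial
      ≤ Real.exp (-μ / 8) := by
  have two_pow_eq : (2 : ℝ) ^ k = Real.exp (k * Real.log 2) := by
    rw [Real.exp_nat_mul, Real.exp_log two_pos]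
  calc ∑ j ∈ Finset.range (k + 1), Real.exp (-μ) * μ ^ j / j.factorial
      = Real.exp (-μ) * ∑ j ∈ Finset.range (k + 1), μ ^ j / j.factorial := by
        simp only [Finset.mul_sum, mul_div_assoc]
    _ ≤ Real.exp (-μ) * (2 ^ k * Real.exp (μ / 2)) := by
        gcongr
        exact sum_range_succ_pow_div_factorial_le hμ.le one_le_two k
    _ = Real.exp (-μ + (k * Real.log 2 + μ / 2)) := by
        rw [two_pow_eq, Real.exp_add, Real.exp_add]
    _ ≤ Real.exp (-μ / 8) := by
        gcongr
        have := mul_le_mul hk Real.log_two_lt_d9.le (Real.log_nonneg one_le_two) (by positivity)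
        linarith
end

section
/- Let (Z_1, Z_2) be a pair of mixed-pair random variables with joint density functions g_{x_1,x_2}(y_1,y_2) and with marginal density functions g_{x_2}(y_2) = ∑_{x_1} ∫_ℝ g_{x_1,x_2}(y_1,y_2) dy_1 for the second component. Assuming the joint pair (Z_1,Z_2) and the marginal Z_2 are good, the conditional entropy H(Z_1|Z_2), defined as H(Z_1,Z_2) − H(Z_2), equals −∑_{x_1,x_2} ∫_{ℝ^2} g_{x_1,x_2}(y_1,y_2) log [ g_{x_1,x_2}(y_1,y_2) / g_{x_2}(y_2) ] dy_1 dy_2. -/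
open MeasureTheory in
/-- A family of functions whose absolute integrals sum to a finite value consists of integrable
functions, and their integrals form a summable family. -/
theorem integrable_and_summable_integral_of_tsum_lintegral_lt_top {ι κ α : Type*}
    [MeasurableSpace α] {μ : Measure α} {f : ι → κ → α → ℝ}
    (hf : ∀ i j, AEStronglyMeasurable (f i j) μ)
    (hfin : ∑' i, ∑' j, ∫⁻ a, ENNReal.ofReal |f i j a| ∂μ < ⊤) :
    (∀ i j, Integrable (f i j) μ) ∧ Summable fun p : ι × κ => ∫ a, f p.1 p.2 a ∂μ := by
  have hsum : ∑' p : ι × κ, ∫⁻ a, ENNReal.ofReal |f p.1 p.2 a| ∂μ ≠ ⊤ := by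
    rw [ENNReal.tsum_prod (f := fun i j => ∫⁻ a, ENNReal.ofReal |f i j a| ∂μ)]
    exact hfin.ne
  have hint : ∀ i j, Integrable (f i j) μ := fun i j => by
    refine ⟨hf i j, ?_⟩
    rw [hasFiniteIntegral_iff_norm]
    exact (ENNReal.ne_top_of_tsum_ne_top hsum (i, j)).lt_top
  refine ⟨hint, Summable.of_norm_bounded (ENNReal.summable_toReal hsum) fun p => ?_⟩
  refine (norm_integral_le_integral_norm _).trans_eq ?_
  exact integral_eq_lintegral_of_nonneg_ae (.of_forall fun _ => norm_nonneg _)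
    (hf p.1 p.2).norm

namespace MeasureTheory

variable {ι α β : Type*} [MeasurableSpace α] [MeasurableSpace β]
  {μ : Measure α} {ν : Measure β}

/-- The density of the second marginal of the family `q`, with values in `[0, ∞]`. -/
noncomputable def sndMarginal (μ : Measure α) (q : ι → α × β → ℝ) (y : β) : ENNReal :=
  ∑' i, ∫⁻ x, ENNReal.ofReal (q i (x, y)) ∂μ

theorem toReal_sndMarginal {q : ι → α × β → ℝ} (hq : ∀ i, Measurable (q i))
    (hq0 : ∀ i z, 0 ≤ q i z) {y : β}
    (hy : sndMarginal μ q y < ⊤) :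
    (sndMarginal μ q y).toReal = ∑' i, ∫ x, q i (x, y) ∂μ := by
  rw [sndMarginal, ENNReal.tsum_toReal_eq fun i => ENNReal.ne_top_of_tsum_ne_top hy.ne i]
  refine tsum_congr fun i => ?_
  exact (integral_eq_lintegral_of_nonneg_ae (.of_forall fun _ => hq0 i _)
    ((hq i).comp measurable_prodMk_right).aestronglyMeasurable).symm

variable [SFinite μ]

theorem measurable_lintegral_ofReal_fst {q : α × β → ℝ} (hq : Measurable q) :
    Measurable fun y => ∫⁻ x, ENNReal.ofReal (q (x, y)) ∂μ :=
  hq.ennreal_ofReal.lintegral_prod_left'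

theorem lintegral_ofReal_mul_snd [SFinite ν] {q : α × β → ℝ} (hq : Measurable q)
    {F : β → ENNReal} (hF : Measurable F) :
    ∫⁻ z, ENNReal.ofReal (q z) * F z.2 ∂(μ.prod ν)
      = ∫⁻ y, (∫⁻ x, ENNReal.ofReal (q (x, y)) ∂μ) * F y ∂ν := by
  have hmeas : Measurable fun z : α × β => ENNReal.ofReal (q z) * F z.2 :=
    hq.ennreal_ofReal.mul (hF.comp measurable_snd)
  rw [lintegral_prod_symm' _ hmeas]
  refine lintegral_congr fun y => ?_
  exact lintegral_mul_const (f := fun x => ENNReal.ofReal (q (x, y))) (F y)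
    (hq.comp measurable_prodMk_right).ennreal_ofReal

variable [Countable ι] {q : ι → α × β → ℝ}

theorem measurable_sndMarginal (hq : ∀ i, Measurable (q i)) :
    Measurable (sndMarginal μ q) :=
  Measurable.tsum fun i => measurable_lintegral_ofReal_fst (hq i)

variable [SFinite ν]

theorem tsum_lintegral_ofReal_mul_snd (hq : ∀ i, Measurable (q i))
    {F : β → ENNReal} (hF : Measurable F) :
    ∑' i, ∫⁻ z, ENNReal.ofReal (q i z) * F z.2 ∂(μ.prod ν)
      = ∫⁻ y, sndMarginal μ q y * F y ∂ν := by
  simp_rw [lintegral_ofReal_mul_snd (hq _) hF, sndMarginal, ← ENNReal.tsum_mul_right]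
  exact (lintegral_tsum fun i =>
    ((measurable_lintegral_ofReal_fst (hq i)).mul hF).aemeasurable).symm

theorem sndMarginal_ae_lt_top (hq : ∀ i, Measurable (q i))
    (hfin : ∑' i, ∫⁻ z, ENNReal.ofReal (q i z) ∂(μ.prod ν) ≠ ⊤) :
    ∀ᵐ y ∂ν, sndMarginal μ q y < ⊤ := by
  refine ae_lt_top (measurable_sndMarginal hq) ?_
  have h := tsum_lintegral_ofReal_mul_snd (μ := μ) (ν := ν) hq (F := fun _ => 1) measurable_const
  simp only [mul_one] at h
  exact h ▸ hfin

/-- The densities vanish almost everywhere on the zero set of their marginal. -/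
theorem ae_eq_zero_of_sndMarginal_eq_zero (hq : ∀ i, Measurable (q i))
    (hq0 : ∀ i z, 0 ≤ q i z) (i : ι) :
    ∀ᵐ z ∂(μ.prod ν), sndMarginal μ q z.2 = 0 → q i z = 0 := by
  have hF : Measurable ((sndMarginal μ q ⁻¹' {0}).indicator (1 : β → ENNReal)) :=
    measurable_one.indicator (measurable_sndMarginal hq (measurableSet_singleton 0))
  have h := tsum_lintegral_ofReal_mul_snd (μ := μ) (ν := ν) hq hF
  have h0 : ∀ y, sndMarginal μ q y * (sndMarginal μ q ⁻¹' {0}).indicator (1 : β → ENNReal) y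
      = 0 := fun y => by
    by_cases hy : sndMarginal μ q y = 0 <;> simp [hy]
  simp only [h0, lintegral_zero, ENNReal.tsum_eq_zero] at h
  have hi := (lintegral_eq_zero_iff
    ((hq i).ennreal_ofReal.mul (hF.comp measurable_snd))).1 (h i)
  filter_upwards [hi] with z hz hz0
  have : ENNReal.ofReal (q i z) = 0 := by simpa [hz0] using hz
  exact le_antisymm (ENNReal.ofReal_eq_zero.1 this) (hq0 i z)

/-- Integrating a function of the second coordinate against the family `q` amounts to integrating
it against the marginal density. -/
theorem tsum_integral_mul_snd (hq : ∀ i, Measurable (q i)) (hq0 : ∀ i z, 0 ≤ q i z)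
    {L : β → ℝ} (hL : Measurable L)
    (hfin : ∑' i, ∫⁻ z, ENNReal.ofReal |q i z * L z.2| ∂(μ.prod ν) ≠ ⊤) :
    ∑' i, ∫ z, q i z * L z.2 ∂(μ.prod ν) = ∫ y, (∑' i, ∫ x, q i (x, y) ∂μ) * L y ∂ν := by
  have hmeas : ∀ i, AEStronglyMeasurable (fun z => q i z * L z.2) (μ.prod ν) := fun i =>
    ((hq i).mul (hL.comp measurable_snd)).aestronglyMeasurable
  have hint : ∀ i, Integrable (fun z => q i z * L z.2) (μ.prod ν) := fun i => by
    refine ⟨hmeas i, ?_⟩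
    rw [hasFiniteIntegral_iff_norm]
    exact (ENNReal.ne_top_of_tsum_ne_top hfin i).lt_top
  have hslice : ∀ i, ∫ z, q i z * L z.2 ∂(μ.prod ν) = ∫ y, (∫ x, q i (x, y) ∂μ) * L y ∂ν :=
    fun i => by
      rw [integral_prod_symm _ (hint i)]
      exact integral_congr_ae (.of_forall fun y => integral_mul_const (L y) fun x => q i (x, y))
  simp_rw [hslice, ← tsum_mul_right]
  refine (integral_tsum (fun i => ?_) (ne_top_of_le_ne_top hfin ?_)).symm
  · have : StronglyMeasurable fun y => ∫ x, q i (x, y) ∂μ :=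
      (hq i).stronglyMeasurable.integral_prod_left'
    exact (this.mul hL.stronglyMeasurable).aestronglyMeasurable
  · refine ENNReal.tsum_le_tsum fun i => ?_
    have habs : ∀ z : α × β, ENNReal.ofReal |q i z * L z.2|
        = ENNReal.ofReal (q i z) * ENNReal.ofReal |L z.2| := fun z => by
      rw [abs_mul, abs_of_nonneg (hq0 i z), ENNReal.ofReal_mul (hq0 i z)]
    simp_rw [habs]
    rw [lintegral_ofReal_mul_snd (hq i) (F := fun y => ENNReal.ofReal |L y|)
      (measurable_abs.comp hL).ennreal_ofReal]
    refine lintegral_mono fun y => ?_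
    rw [enorm_mul]
    refine mul_le_mul' ((enorm_integral_le_lintegral_enorm _).trans_eq ?_) ?_
    · exact lintegral_congr fun x => Real.enorm_of_nonneg (hq0 i _)
    · rw [Real.enorm_eq_ofReal_abs]

end MeasureTheory

/- STATEMENT 13: For a pair (Z₁, Z₂) of mixed-pair random variables with joint
densities q_{x₁,x₂}(y₁,y₂) and second-component marginal densities g₂, assuming the
joint pair and the marginal Z₂ are good, the conditional entropy
H(Z₁|Z₂) = H(Z₁,Z₂) − H(Z₂) equals
−∑_{x₁,x₂} ∫_{ℝ²} q log (q / g₂) . -/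
theorem mixed_pair_conditional_entropy_formula
    (q : ℕ → ℕ → ℝ × ℝ → ℝ) (g2 : ℕ → ℝ → ℝ)
    (hqmeas : ∀ i j, Measurable (q i j))
    (hqnonneg : ∀ i j z, 0 ≤ q i j z)
    (htotal : ∑' i, ∑' j, ∫⁻ z, ENNReal.ofReal (q i j z) = 1)
    (hg2 : ∀ j y₂, g2 j y₂ = ∑' i, ∫ y₁, q i j (y₁, y₂))
    (hgood : ∑' i, ∑' j, ∫⁻ z, ENNReal.ofReal |q i j z * Real.log (q i j z)| < ⊤)
    (hgood2 : ∑' j, ∫⁻ y, ENNReal.ofReal |g2 j y * Real.log (g2 j y)| < ⊤) :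
    (-∑' i, ∑' j, ∫ z, q i j z * Real.log (q i j z))
        - (-∑' j, ∫ y, g2 j y * Real.log (g2 j y))
      = -∑' i, ∑' j, ∫ z, q i j z * Real.log (q i j z / g2 j z.2) := by
  have hfin : ∀ j, ∑' i, ∫⁻ z, ENNReal.ofReal (q i j z) ≠ ⊤ := by
    rw [ENNReal.tsum_comm] at htotal
    exact fun j => ENNReal.ne_top_of_tsum_ne_top (htotal ▸ ENNReal.one_ne_top) j
  let G : ℕ → ℝ → ENNReal := fun j => MeasureTheory.sndMarginal MeasureTheory.volume (q · j)
  let L : ℕ → ℝ → ℝ := fun j y => Real.log (G j y).toReal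
  have hL : ∀ j, Measurable (L j) := fun j =>
    (MeasureTheory.measurable_sndMarginal (hqmeas · j)).ennreal_toReal.log
  have hGtop : ∀ j, ∀ᵐ y, G j y < ⊤ := fun j =>
    MeasureTheory.sndMarginal_ae_lt_top (hqmeas · j) (hfin j)
  have hGg : ∀ j, ∀ᵐ y, (G j y).toReal = g2 j y := fun j => by
    filter_upwards [hGtop j] with y hy
    rw [hg2, MeasureTheory.toReal_sndMarginal (hqmeas · j) (hqnonneg · j) hy]
  have hmarg : ∀ j, ∑' i, ∫⁻ z, ENNReal.ofReal |q i j z * L j z.2|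
      = ∫⁻ y, ENNReal.ofReal |g2 j y * Real.log (g2 j y)| := fun j => by
    simp_rw [abs_mul, abs_of_nonneg (hqnonneg _ j _), ENNReal.ofReal_mul (hqnonneg _ j _)]
    refine (MeasureTheory.tsum_lintegral_ofReal_mul_snd (hqmeas · j)
      (F := fun y => ENNReal.ofReal |L j y|)
      (measurable_abs.comp (hL j)).ennreal_ofReal).trans ?_
    refine MeasureTheory.lintegral_congr_ae ?_
    filter_upwards [hGtop j, hGg j] with y hy hyg
    have h0 : 0 ≤ g2 j y := hyg ▸ ENNReal.toReal_nonneg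
    rw [abs_of_nonneg h0, ENNReal.ofReal_mul h0]
    simp only [L, hyg]
    rw [← hyg, ENNReal.ofReal_toReal hy.ne]
  have hsum2 : ∑' i, ∑' j, ∫⁻ z, ENNReal.ofReal |q i j z * L j z.2| < ⊤ := by
    rw [ENNReal.tsum_comm]
    simp_rw [hmarg]
    exact hgood2
  obtain ⟨hA, hAs⟩ := integrable_and_summable_integral_of_tsum_lintegral_lt_top
    (f := fun i j z => q i j z * Real.log (q i j z))
    (fun i j => ((hqmeas i j).mul (hqmeas i j).log).aestronglyMeasurable) hgood
  obtain ⟨hB, hBs⟩ := integrable_and_summable_integral_of_tsum_lintegral_lt_top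
    (f := fun i j z => q i j z * L j z.2)
    (fun i j => ((hqmeas i j).mul ((hL j).comp measurable_snd)).aestronglyMeasurable) hsum2
  have hC : ∀ i j, ∫ z, q i j z * Real.log (q i j z / g2 j z.2)
      = (∫ z, q i j z * Real.log (q i j z)) - ∫ z, q i j z * L j z.2 := fun i j => by
    rw [← MeasureTheory.integral_sub (hA i j) (hB i j)]
    refine MeasureTheory.integral_congr_ae ?_
    filter_upwards [MeasureTheory.Measure.quasiMeasurePreserving_snd.ae (hGg j),
      MeasureTheory.Measure.quasiMeasurePreserving_snd.ae (hGtop j),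
      MeasureTheory.ae_eq_zero_of_sndMarginal_eq_zero (hqmeas · j) (hqnonneg · j) i]
      with z hzg hztop hz0
    by_cases hq : q i j z = 0
    · simp [hq]
    · have hg : g2 j z.2 ≠ 0 := hzg ▸ ENNReal.toReal_ne_zero.2 ⟨fun h => hq (hz0 h), hztop.ne⟩
      simp only [L, hzg, Real.log_div hq hg, mul_sub]
  have hBj : ∀ j, ∑' i, ∫ z, q i j z * L j z.2 = ∫ y, g2 j y * Real.log (g2 j y) := fun j => by
    refine (MeasureTheory.tsum_integral_mul_snd (hqmeas · j) (hqnonneg · j) (hL j) ?_).trans ?_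
    · rw [ENNReal.tsum_comm] at hsum2
      exact ENNReal.ne_top_of_tsum_ne_top hsum2.ne j
    · refine MeasureTheory.integral_congr_ae ?_
      filter_upwards [hGg j] with y hy
      simp only [L, hy, ← hg2]
  have hdiff : ∑' i, ∑' j, ((∫ z, q i j z * Real.log (q i j z)) - ∫ z, q i j z * L j z.2)
      = (∑' i, ∑' j, ∫ z, q i j z * Real.log (q i j z))
        - ∑' i, ∑' j, ∫ z, q i j z * L j z.2 := by
    rw [← (hAs.sub hBs).tsum_prod, hAs.tsum_sub hBs, hAs.tsum_prod, hBs.tsum_prod]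
  have hswap : ∑' j, ∑' i, ∫ z, q i j z * L j z.2 = ∑' i, ∑' j, ∫ z, q i j z * L j z.2 :=
    Summable.tsum_comm (f := fun i j => ∫ z, q i j z * L j z.2) hBs
  simp_rw [hC, ← hBj]
  rw [hdiff, hswap]
  ring
end
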